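/- If cov*(𝒩) ≥ 𝔡 then cov*(𝒩) = non(ℳ). -/

import Mathlib

open Cardinal MeasureTheory Set Filter

/-- `cov*(𝒩)`: the least cardinality of a family `𝒜` of null subsets of the plane such that
for every Borel function `f : ℝ → ℝ` and every Borel set `B ⊆ ℝ` of positive Lebesgue measure
there is `H ∈ 𝒜` with `{x ∈ B : (x, f x) ∈ H}` not Lebesgue-null. -/
noncomputable def covStarN : Cardinal :=
  sInf { c : Cardinal | ∃ A : Set (Set (ℝ × ℝ)), #A = c ∧ (∀ H ∈ A, volume H = 0) ∧
    ∀ f : ℝ → ℝ, Measurable f → ∀ B : Set ℝ, MeasurableSet B → 0 < volume B →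
      ∃ H ∈ A, volume {x | x ∈ B ∧ (x, f x) ∈ H} ≠ 0 }

/-- The dominating number `𝔡`. -/
noncomputable def frakd : Cardinal :=
  sInf { c : Cardinal | ∃ F : Set (ℕ → ℕ), #F = c ∧
    ∀ g : ℕ → ℕ, ∃ f ∈ F, ∀ᶠ n in atTop, g n ≤ f n }

/-- `non(ℳ)`: the least cardinality of a non-meager subset of `ℝ`. -/
noncomputable def nonMeager : Cardinal :=
  sInf { c : Cardinal | ∃ X : Set ℝ, #X = c ∧ ¬ IsMeagre X }

/-- A sequence of functions `ℝ → ℕ` taking every prescribed sequence of values infinitely often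
at comeagerly many points. -/
noncomputable def fractCode (x : ℝ) (m : ℕ) : ℕ := ⌊(Int.fract (m * x))⁻¹⌋₊ - 1

theorem fractCode_eq_of_mem_Ioo {x : ℝ} {m k : ℕ} {p : ℤ}
    (h : m * x - p ∈ Ioo (1 / (k + 2) : ℝ) (1 / (k + 1))) : fractCode x m = k := by
  obtain ⟨h1, h2⟩ := h
  have hpos : (0 : ℝ) < m * x - p := lt_trans (by positivity) h1
  have hlt : (m * x - p : ℝ) < 1 :=
    h2.trans_le (by rw [div_le_one (by positivity)]; linarith [(Nat.cast_nonneg k : (0 : ℝ) ≤ k)])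
  have hf : Int.fract (m * x) = m * x - p := by
    rw [Int.fract_eq_iff]
    exact ⟨hpos.le, hlt, p, by ring⟩
  have hfl : ⌊(Int.fract (m * x))⁻¹⌋₊ = k + 1 := by
    rw [hf, Nat.floor_eq_iff (by positivity)]
    push_cast
    constructor
    · rw [le_inv_comm₀ (by positivity) hpos, ← one_div]
      exact h2.le
    · rw [inv_lt_comm₀ hpos (by positivity), ← one_div]
      convert h1 using 2
      ring
  simp [fractCode, hfl]

theorem frequently_fractCode_eq_mem_residual (g : ℕ → ℕ) :
    {x : ℝ | ∃ᶠ m in atTop, fractCode x m = g m} ∈ residual ℝ := by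
  have key : ∀ N : ℕ, {x : ℝ | ∃ m ≥ N, fractCode x m = g m} ∈ residual ℝ := by
    intro N
    let W : Set ℝ := ⋃ m : {m : ℕ // N ≤ m}, ⋃ p : ℤ,
      {x : ℝ | (m : ℕ) * x - p ∈ Ioo (1 / (g m + 2) : ℝ) (1 / (g m + 1))}
    have hW : IsOpen W := isOpen_iUnion fun m => isOpen_iUnion fun p =>
      isOpen_Ioo.preimage (by fun_prop)
    have hd : Dense W := by
      rw [Metric.dense_iff]
      intro x ε hε
      obtain ⟨m, hm⟩ := exists_nat_gt (max (N : ℝ) ε⁻¹)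
      have hmN : N ≤ m := by exact_mod_cast ((le_max_left _ _).trans_lt hm).le
      have hmε : ε⁻¹ < m := (le_max_right _ _).trans_lt hm
      have hm0 : (0 : ℝ) < m := (inv_pos.2 hε).trans hmε
      have hlt : (1 / (g m + 2) : ℝ) < 1 / (g m + 1) :=
        one_div_lt_one_div_of_lt (by positivity) (by linarith)
      obtain ⟨u, hu1, hu2⟩ := exists_between hlt
      have hu0 : 0 < u := lt_trans (by positivity) hu1
      have hu3 : u < 1 := hu2.trans_le (by
        rw [div_le_one (by positivity)]; linarith [(Nat.cast_nonneg (g m) : (0 : ℝ) ≤ g m)])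
      refine ⟨(⌊m * x⌋ + u) / m, ?_, ?_⟩
      · rw [Metric.mem_ball, Real.dist_eq]
        have h1 : (⌊m * x⌋ + u) / m - x = (u - Int.fract (m * x)) / m := by
          rw [Int.fract]; field_simp; ring
        rw [h1, abs_div, abs_of_pos hm0, div_lt_iff₀ hm0]
        have h2 : 1 < ε * m := by
          rw [inv_lt_iff_one_lt_mul₀ hε] at hmε; linarith
        refine lt_trans ?_ h2
        rw [abs_lt]
        constructor <;> linarith [Int.fract_nonneg (m * x), Int.fract_lt_one (m * x)]
      · refine mem_iUnion.2 ⟨⟨m, hmN⟩, mem_iUnion.2 ⟨⌊m * x⌋, ?_⟩⟩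
        have : (m : ℝ) * ((⌊m * x⌋ + u) / m) - ⌊m * x⌋ = u := by field_simp; ring
        rw [mem_ofPred_eq, this]
        exact ⟨hu1, hu2⟩
    refine mem_of_superset (residual_of_dense_open hW hd) ?_
    intro x hx
    obtain ⟨m, hx⟩ := mem_iUnion.1 hx
    obtain ⟨p, hx⟩ := mem_iUnion.1 hx
    exact ⟨m, m.2, fractCode_eq_of_mem_Ioo hx⟩
  have := countable_iInter_mem.2 key
  refine mem_of_superset this ?_
  intro x hx
  rw [mem_ofPred_eq, frequently_atTop]
  exact fun N => mem_iInter.1 hx N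

theorem exists_bounded_piece {f : ℝ → ℝ} (hf : Measurable f) {B : Set ℝ} (hB : MeasurableSet B)
    (h0 : 0 < volume B) :
    ∃ C ⊆ B, MeasurableSet C ∧ 0 < volume C ∧ volume C < ⊤ ∧ ∃ K : ℝ, ∀ x ∈ C, |f x| ≤ K := by
  let C : ℕ → Set ℝ := fun N => B ∩ Icc (-N : ℝ) N ∩ {x | |f x| ≤ N}
  have hU : B ⊆ ⋃ N, C N := by
    intro x hx
    obtain ⟨N, hN⟩ := exists_nat_ge (max |x| |f x|)
    exact mem_iUnion.2 ⟨N, ⟨hx, abs_le.1 ((le_max_left _ _).trans hN)⟩, (le_max_right _ _).trans hN⟩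
  obtain ⟨N, hN⟩ := exists_measure_pos_of_not_measure_iUnion_null (μ := volume) (s := C)
    (fun h => h0.ne' (measure_mono_null hU h))
  refine ⟨C N, fun x hx => hx.1.1, ?_, hN, ?_, N, fun x hx => hx.2⟩
  · exact (hB.inter measurableSet_Icc).inter (measurableSet_le (by fun_prop) measurable_const)
  · refine (measure_mono (fun x hx => hx.1.2 : C N ⊆ Icc (-N : ℝ) N)).trans_lt ?_
    simp

/-- There are countably many measurable functions such that every measurable function is, on a
part of positive measure of any given set, approximated by them with any prescribed speed. -/
theorem exists_approximating_sequence :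
    ∃ φ : ℕ → ℝ → ℝ, (∀ k, Measurable (φ k)) ∧ ∀ f : ℝ → ℝ, Measurable f → ∀ B : Set ℝ,
      MeasurableSet B → 0 < volume B → ∃ C ⊆ B, 0 < volume C ∧ ∃ g : ℕ → ℕ,
        ∀ᵐ x ∂volume, x ∈ C → ∀ᶠ n in atTop, |f x - φ (g n) x| < (1 / 2) ^ n := by
  have : Fact ((1 : ENNReal) ≠ ⊤) := ⟨by simp⟩
  let d := TopologicalSpace.denseSeq (Lp ℝ 1 (volume : Measure ℝ))
  have hd : DenseRange d := TopologicalSpace.denseRange_denseSeq _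
  refine ⟨fun k => d k, fun k => (Lp.stronglyMeasurable (d k)).measurable, ?_⟩
  intro f hf B hB h0
  obtain ⟨C, hCB, hCm, hC0, hCt, K, hK⟩ := exists_bounded_piece hf hB h0
  refine ⟨C, hCB, hC0, ?_⟩
  have hint : IntegrableOn f C volume :=
    Measure.integrableOn_of_bounded (M := K) hCt.ne hf.aestronglyMeasurable
      ((ae_restrict_iff' hCm).2 (ae_of_all _ fun x hx => by simpa using hK x hx))
  have hmem : MemLp (C.indicator f) 1 volume :=
    memLp_one_iff_integrable.2 ((integrable_indicator_iff hCm).2 hint)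
  have hex : ∀ n : ℕ, ∃ k, edist (hmem.toLp) (d k) < ENNReal.ofReal ((1 / 4) ^ n) := by
    intro n
    have hcl : hmem.toLp ∈ closure (range d) := hd _
    obtain ⟨_, ⟨k, rfl⟩, hy⟩ := Metric.mem_closure_iff.1 hcl ((1 / 4) ^ n) (by positivity)
    rw [← edist_lt_ofReal] at hy
    exact ⟨k, hy⟩
  choose g hg using hex
  refine ⟨g, ?_⟩
  have hm : ∀ n : ℕ, volume {x | ENNReal.ofReal ((1 / 2) ^ n) ≤ ‖C.indicator f x - d (g n) x‖ₑ}
      ≤ ENNReal.ofReal ((1 / 2) ^ n) := by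
    intro n
    have hne : ENNReal.ofReal ((1 / 2) ^ n) ≠ 0 := by
      rw [Ne, ENNReal.ofReal_eq_zero, not_le]; positivity
    have h1 : eLpNorm (C.indicator f - (d (g n) : ℝ → ℝ)) 1 volume < ENNReal.ofReal ((1 / 4) ^ n) := by
      refine lt_of_eq_of_lt (eLpNorm_congr_ae ?_) ((Lp.edist_def _ _).symm.trans_lt (hg n))
      filter_upwards [hmem.coeFn_toLp] with x hx
      simp [hx]
    have h2 := meas_ge_le_mul_pow_eLpNorm_enorm volume (p := 1) one_ne_zero ENNReal.one_ne_top
      (f := C.indicator f - (d (g n) : ℝ → ℝ))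
      ((hf.indicator hCm).aestronglyMeasurable.sub (Lp.aestronglyMeasurable _)) hne
      (fun h => absurd h ENNReal.ofReal_ne_top)
    simp only [ENNReal.toReal_one, ENNReal.rpow_one] at h2
    refine h2.trans ((mul_le_mul_right h1.le _).trans ?_)
    rw [← ENNReal.ofReal_inv_of_pos (by positivity), ← ENNReal.ofReal_mul (by positivity)]
    apply ENNReal.ofReal_le_ofReal
    rw [← inv_pow, ← mul_pow]
    norm_num
  have hsum : ∑' n : ℕ, volume {x | ENNReal.ofReal ((1 / 2) ^ n) ≤ ‖C.indicator f x - d (g n) x‖ₑ}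
      ≠ ⊤ := by
    refine ne_top_of_le_ne_top ?_ (ENNReal.tsum_le_tsum hm)
    rw [← ENNReal.ofReal_tsum_of_nonneg (fun n => by positivity) summable_geometric_two]
    exact ENNReal.ofReal_ne_top
  filter_upwards [ae_eventually_notMem hsum] with x hx hxC
  filter_upwards [hx] with n hn
  rw [not_le, indicator_of_mem hxC, Real.enorm_eq_ofReal_abs,
    ENNReal.ofReal_lt_ofReal_iff (by positivity)] at hn
  exact hn

theorem volume_frequently_near_eq_zero (φ : ℕ → ℝ → ℝ) (hφ : ∀ k, Measurable (φ k)) :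
    volume {z : ℝ × ℝ | ∃ᶠ n in atTop, |z.2 - φ n z.1| < (1 / 2) ^ n} = 0 := by
  have hmeas : ∀ n, MeasurableSet {z : ℝ × ℝ | |z.2 - φ n z.1| < (1 / 2) ^ n} := fun n =>
    measurableSet_lt (by have := hφ n; fun_prop) measurable_const
  have heq : {z : ℝ × ℝ | ∃ᶠ n in atTop, |z.2 - φ n z.1| < (1 / 2) ^ n} =
      limsup (fun n => {z : ℝ × ℝ | |z.2 - φ n z.1| < (1 / 2) ^ n}) atTop := by
    rw [limsup_eq_iInf_iSup_of_nat]
    ext z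
    simp [frequently_atTop]
  have hm : MeasurableSet {z : ℝ × ℝ | ∃ᶠ n in atTop, |z.2 - φ n z.1| < (1 / 2) ^ n} := by
    rw [heq]
    exact MeasurableSet.measurableSet_limsup hmeas
  rw [Measure.volume_eq_prod, Measure.measure_prod_null hm]
  refine ae_of_all _ fun x => ?_
  have hsum : ∑' n : ℕ, volume (Metric.ball (φ n x) ((1 / 2) ^ n)) ≠ ⊤ := by
    simp only [Real.volume_ball]
    rw [← ENNReal.ofReal_tsum_of_nonneg (fun n => by positivity)
      (summable_geometric_two.mul_left 2)]
    exact ENNReal.ofReal_ne_top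
  have := ae_eventually_notMem hsum
  rw [ae_iff] at this
  refine Eq.trans (congrArg volume ?_) this
  ext y
  simp [Filter.Frequently, Real.dist_eq]

theorem mem_covStarN_set_of_not_isMeagre {X : Set ℝ} (hX : ¬ IsMeagre X) :
    ∃ A : Set (Set (ℝ × ℝ)), #A ≤ #X ∧ (∀ H ∈ A, volume H = 0) ∧
      ∀ f : ℝ → ℝ, Measurable f → ∀ B : Set ℝ, MeasurableSet B → 0 < volume B →
        ∃ H ∈ A, volume {x | x ∈ B ∧ (x, f x) ∈ H} ≠ 0 := by
  obtain ⟨φ, hφ, happ⟩ := exists_approximating_sequence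
  let H : X → Set (ℝ × ℝ) := fun u =>
    {z | ∃ᶠ n in atTop, |z.2 - φ (fractCode u n) z.1| < (1 / 2) ^ n}
  refine ⟨range H, mk_range_le, ?_, ?_⟩
  · rintro _ ⟨u, rfl⟩
    exact volume_frequently_near_eq_zero (fun n => φ (fractCode u n)) fun n => hφ _
  · intro f hf B hB h0
    obtain ⟨C, hCB, hC0, g, hg⟩ := happ f hf B hB h0
    obtain ⟨u, huX, hu⟩ : ∃ u ∈ X, ∃ᶠ m in atTop, fractCode u m = g m := by
      by_contra! hcon
      refine hX (mem_of_superset (frequently_fractCode_eq_mem_residual g) ?_)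
      intro u hu huX
      exact hu (hcon u huX)
    refine ⟨_, ⟨⟨u, huX⟩, rfl⟩, fun hnull => hC0.ne' ?_⟩
    refine measure_mono_null ?_ (measure_union_null hnull (ae_iff.1 hg))
    intro x hx
    by_cases hc : ∀ᶠ n in atTop, |f x - φ (g n) x| < (1 / 2) ^ n
    · refine Or.inl ⟨hCB hx, ?_⟩
      refine (hu.and_eventually hc).mono fun n hn => ?_
      change |f x - φ (fractCode u n) x| < _
      rw [hn.1]
      exact hn.2
    · exact Or.inr fun h => hc (h hx)

theorem finite_encode_le (k : ℕ) : {q : ℚ | Encodable.encode q ≤ k}.Finite :=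
  (finite_Iic k).preimage Encodable.encode_injective.injOn

/-- A stage of the construction of a real as a sum of small rationals: the number of terms chosen so
far, a finite set containing all possible partial sums, and a bound for the next term. -/
abbrev SumStage : Type := ℕ × Finset ℚ × ℚ

/-- The stages determined by a bound `K` on the codes of the terms. -/
noncomputable def sumStage (K : SumStage → ℕ) : ℕ → SumStage
  | 0 => (0, {0}, 1)
  | n + 1 =>
    (n + 1,
      (sumStage K n).2.1 ∪ Finset.image₂ (· + ·) (sumStage K n).2.1
        (finite_encode_le (K (sumStage K n))).toFinset,
      (sumStage K n).2.2 / (K (sumStage K n) + 2))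

/-- The `n`-th term, which is the value suggested by `f` if that is admissible. -/
noncomputable def sumTerm (K : SumStage → ℕ) (f : ℕ → ℚ) (n : ℕ) : ℚ :=
  open Classical in
  if Encodable.encode (f n) ≤ K (sumStage K n) ∧ 0 < f n ∧ f n < (sumStage K n).2.2 then f n else 0

section sumStage

variable (K : SumStage → ℕ) (f : ℕ → ℚ)

theorem sumStage_fst (n : ℕ) : (sumStage K n).1 = n := by
  cases n <;> rfl

theorem sumStage_injective : Function.Injective (sumStage K) := fun m n h => by
  rw [← sumStage_fst K m, ← sumStage_fst K n, h]

theorem sumStage_bound_pos (n : ℕ) : 0 < (sumStage K n).2.2 := by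
  induction n with
  | zero => simp [sumStage]
  | succ n ih => simp only [sumStage]; positivity

theorem sumStage_bound_succ (n : ℕ) :
    (sumStage K (n + 1)).2.2 = (sumStage K n).2.2 / (K (sumStage K n) + 2) := rfl

theorem sumStage_bound_succ_le (n : ℕ) :
    2 * (sumStage K (n + 1)).2.2 ≤ (sumStage K n).2.2 := by
  have := sumStage_bound_pos K n
  rw [sumStage_bound_succ, ← mul_div_assoc, div_le_iff₀ (by positivity)]
  nlinarith [(Nat.cast_nonneg (K (sumStage K n)) : (0 : ℚ) ≤ _)]

theorem sumStage_bound_le (n : ℕ) : (sumStage K n).2.2 ≤ (1 / 2) ^ n := by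
  induction n with
  | zero => simp [sumStage]
  | succ n ih => rw [pow_succ]; linarith [sumStage_bound_succ_le K n]

theorem sumTerm_nonneg (n : ℕ) : 0 ≤ sumTerm K f n := by
  unfold sumTerm; split_ifs with h
  · exact h.2.1.le
  · exact le_rfl

theorem sumTerm_le (n : ℕ) : sumTerm K f n ≤ (sumStage K n).2.2 := by
  unfold sumTerm; split_ifs with h
  · exact h.2.2.le
  · exact (sumStage_bound_pos K n).le

theorem sum_sumTerm_mem (n : ℕ) : ∑ j ∈ Finset.range n, sumTerm K f j ∈ (sumStage K n).2.1 := by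
  induction n with
  | zero => simp [sumStage]
  | succ n ih =>
    rw [Finset.sum_range_succ]
    simp only [sumStage, Finset.mem_union]
    by_cases h : Encodable.encode (f n) ≤ K (sumStage K n) ∧ 0 < f n ∧ f n < (sumStage K n).2.2
    · right
      refine Finset.mem_image₂_of_mem ih ?_
      simp [sumTerm, h]
    · left
      simpa [sumTerm, h] using ih

/-- The real number built from the bounds `K` and the suggestions `f`. -/
noncomputable def sumReal : ℝ := ∑' n, (sumTerm K f n : ℝ)

theorem summable_sumTerm : Summable fun n => (sumTerm K f n : ℝ) := by
  refine Summable.of_nonneg_of_le (fun n => by exact_mod_cast sumTerm_nonneg K f n)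
    (fun n => ?_) summable_geometric_two
  have h : ((sumTerm K f n : ℚ) : ℝ) ≤ (((1 / 2) ^ n : ℚ) : ℝ) :=
    Rat.cast_le.2 ((sumTerm_le K f n).trans (sumStage_bound_le K n))
  simpa using h

theorem sumReal_mem_Icc (n : ℕ) :
    sumReal K f ∈ Icc ((∑ j ∈ Finset.range n, sumTerm K f j : ℚ) : ℝ)
      ((∑ j ∈ Finset.range n, sumTerm K f j : ℚ) + 2 * ((sumStage K n).2.2 : ℝ)) := by
  constructor
  · push_cast
    exact (summable_sumTerm K f).sum_le_tsum _ fun j _ => by exact_mod_cast sumTerm_nonneg K f j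
  · have hanti : Antitone fun m => ∑ j ∈ Finset.range m, sumTerm K f j + 2 * (sumStage K m).2.2 := by
      refine antitone_nat_of_succ_le fun m => ?_
      rw [Finset.sum_range_succ]
      linarith [sumTerm_le K f m, sumStage_bound_succ_le K m]
    refine le_of_tendsto (summable_sumTerm K f).hasSum.tendsto_sum_nat ?_
    filter_upwards [eventually_ge_atTop n] with m hm
    have h1 := hanti hm
    have h2 := sumStage_bound_pos K m
    have h3 : ∑ j ∈ Finset.range m, sumTerm K f j ≤
        ∑ j ∈ Finset.range n, sumTerm K f j + 2 * (sumStage K n).2.2 := by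
      simp only at h1; linarith
    exact_mod_cast h3

end sumStage

theorem exists_common_translate {D : Set ℝ} (hD : IsOpen D) (hd : Dense D) (P : Finset ℚ) {ε : ℚ}
    (hε : 0 < ε) : ∃ q : ℚ, 0 < q ∧ q < ε ∧ ∃ ρ : ℝ, 0 < ρ ∧
      ∀ p ∈ P, Icc ((p + q : ℚ) : ℝ) ((p + q : ℚ) + ρ) ⊆ D := by
  have hfin : IsOpen (⋂ p ∈ P, (fun x : ℝ => (p : ℝ) + x) ⁻¹' D) ∧
      Dense (⋂ p ∈ P, (fun x : ℝ => (p : ℝ) + x) ⁻¹' D) := by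
    constructor
    · exact isOpen_biInter_finset fun p _ => hD.preimage (by fun_prop)
    · refine dense_biInter_of_isOpen (S := (P : Set ℚ)) (fun p _ => hD.preimage (by fun_prop))
        P.countable_toSet (fun p _ => ?_)
      exact hd.preimage (Homeomorph.addLeft (p : ℝ)).isOpenMap
  obtain ⟨x, hx, hxW⟩ := hfin.2.inter_open_nonempty (Ioo 0 (ε : ℝ)) isOpen_Ioo
    (nonempty_Ioo.2 (by exact_mod_cast hε))
  have hopen : IsOpen (Ioo 0 (ε : ℝ) ∩ ⋂ p ∈ P, (fun x : ℝ => (p : ℝ) + x) ⁻¹' D) :=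
    isOpen_Ioo.inter hfin.1
  obtain ⟨_, hq, q, rfl⟩ := Rat.denseRange_cast (𝕜 := ℝ) |>.inter_open_nonempty _ hopen ⟨x, hx, hxW⟩
  obtain ⟨ρ, hρ, hball⟩ := Metric.isOpen_iff.1 hopen _ hq
  refine ⟨q, by exact_mod_cast hq.1.1, by exact_mod_cast hq.1.2, ρ / 2, by positivity, ?_⟩
  intro p hp y hy
  have hy' : y - p ∈ Metric.ball (q : ℝ) ρ := by
    rw [Metric.mem_ball, Real.dist_eq, abs_lt]
    push_cast at hy
    constructor <;> linarith [hy.1, hy.2]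
  have := mem_iInter₂.1 (hball hy').2 p hp
  simpa using this

theorem exists_seq_of_mem_residual {s : Set ℝ} (hs : s ∈ residual ℝ) :
    ∃ D : ℕ → Set ℝ, (∀ n, IsOpen (D n)) ∧ (∀ n, Dense (D n)) ∧ Antitone D ∧ ⋂ n, D n ⊆ s := by
  obtain ⟨S, hSo, hSd, hSc, hS⟩ := mem_residual_iff.1 hs
  obtain ⟨E, hE⟩ := (hSc.insert Set.univ).exists_eq_range (insert_nonempty _ _)
  have hEo : ∀ n, IsOpen (E n) := fun n => by
    have : E n ∈ insert Set.univ S := hE ▸ mem_range_self n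
    rcases this with h | h
    · rw [h]; exact isOpen_univ
    · exact hSo _ h
  have hEd : ∀ n, Dense (E n) := fun n => by
    have : E n ∈ insert Set.univ S := hE ▸ mem_range_self n
    rcases this with h | h
    · rw [h]; exact dense_univ
    · exact hSd _ h
  refine ⟨fun n => ⋂ j ∈ Finset.range (n + 1), E j, ?_, ?_, ?_, ?_⟩
  · exact fun n => isOpen_biInter_finset fun j _ => hEo j
  · exact fun n => dense_biInter_of_isOpen (S := (Finset.range (n + 1) : Set ℕ)) (fun j _ => hEo j)
      (Finset.countable_toSet _) fun j _ => hEd j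
  · intro m n hmn x hx
    simp only [mem_iInter, Finset.mem_range] at hx ⊢
    exact fun j hj => hx j (by omega)
  · intro x hx
    refine hS fun t ht => ?_
    obtain ⟨j, rfl⟩ : t ∈ range E := hE ▸ mem_insert_of_mem _ ht
    have := mem_iInter.1 hx j
    simp only [mem_iInter, Finset.mem_range] at this
    exact this j (by omega)

/-- A dominating family together with a family of infinitely equal functions yields a
non-meagre set of reals. -/
theorem not_isMeagre_range_sumReal {ι κ : Type} (K : ι → SumStage → ℕ) (f : κ → ℕ → ℚ)
    (hK : ∀ G : SumStage → ℕ, ∃ i, ∀ᶠ s in cofinite, G s ≤ K i s)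
    (hf : ∀ g : ℕ → ℚ, ∃ k, ∃ᶠ n in atTop, f k n = g n) :
    ¬ IsMeagre (range fun z : ι × κ => sumReal (K z.1) (f z.2)) := by
  intro hmeagre
  obtain ⟨D, hDo, hDd, hDa, hD⟩ := exists_seq_of_mem_residual hmeagre
  have key : ∀ s : SumStage, ∃ q : ℚ, ∃ N : ℕ, 0 < s.2.2 → 0 < q ∧ q < s.2.2 ∧
      Encodable.encode q ≤ N ∧
      ∀ p ∈ s.2.1, Icc ((p + q : ℚ) : ℝ) ((p + q : ℚ) + 2 * ((s.2.2 / (N + 2) : ℚ) : ℝ)) ⊆ D s.1 := by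
    intro s
    by_cases hs : 0 < s.2.2
    · obtain ⟨q, hq0, hq1, ρ, hρ, hq⟩ := exists_common_translate (hDo s.1) (hDd s.1) s.2.1 hs
      obtain ⟨M, hM⟩ := exists_nat_gt (2 * (s.2.2 : ℝ) / ρ)
      refine ⟨q, max M (Encodable.encode q), fun _ => ⟨hq0, hq1, le_max_right _ _, ?_⟩⟩
      intro p hp
      refine (Icc_subset_Icc_right ?_).trans (hq p hp)
      rw [add_le_add_iff_left]
      have h1 : (M : ℝ) ≤ max M (Encodable.encode q) := by exact_mod_cast le_max_left _ _
      push_cast at h1 ⊢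
      rw [← mul_div_assoc, div_le_iff₀ (by positivity)]
      rw [div_lt_iff₀ hρ] at hM
      nlinarith
    · exact ⟨0, 0, fun h => absurd h hs⟩
  choose q N hqN using key
  obtain ⟨i, hi⟩ := hK N
  obtain ⟨k, hk⟩ := hf fun n => q (sumStage (K i) n)
  have hi' : ∀ᶠ n in atTop, N (sumStage (K i) n) ≤ K i (sumStage (K i) n) := by
    rw [← Nat.cofinite_eq_atTop]
    exact (sumStage_injective (K i)).tendsto_cofinite.eventually hi
  have hfreq : ∃ᶠ n in atTop, sumReal (K i) (f k) ∈ D n := by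
    refine (hk.and_eventually hi').mono fun n hn => ?_
    obtain ⟨hfn, hKn⟩ := hn
    have hpos := sumStage_bound_pos (K i) n
    obtain ⟨hq0, hq1, hq2, hq3⟩ := hqN _ hpos
    have hterm : sumTerm (K i) (f k) n = q (sumStage (K i) n) := by
      unfold sumTerm
      rw [if_pos]
      · exact hfn
      · rw [hfn]; exact ⟨hq2.trans hKn, hq0, hq1⟩
    have hx := sumReal_mem_Icc (K i) (f k) (n + 1)
    rw [Finset.sum_range_succ, hterm, sumStage_bound_succ] at hx
    have h3 := hq3 _ (sum_sumTerm_mem (K i) (f k) n)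
    rw [sumStage_fst] at h3
    refine h3 ⟨hx.1, hx.2.trans ?_⟩
    gcongr
  have hall : sumReal (K i) (f k) ∈ ⋂ n, D n := mem_iInter.2 fun n => by
    obtain ⟨m, hm, hx⟩ := frequently_atTop.1 hfreq n
    exact hDa hm hx
  exact hD hall ⟨(i, k), rfl⟩

/-- Slaloms of prescribed finite widths that capture every function infinitely often yield equally
many functions that are infinitely often equal to every function. -/
theorem exists_infinitely_equal_of_slaloms {κ : Type} (w : List ℕ → ℕ)
    (S : κ → List ℕ → Finset ℕ) (hw : ∀ k s, (S k s).card ≤ w s)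
    (hS : ∀ g : List ℕ → ℕ, ∃ k, ∃ᶠ s in cofinite, g s ∈ S k s) :
    ∃ f : κ → ℕ → ℚ, ∀ g : ℕ → ℚ, ∃ k, ∃ᶠ n in atTop, f k n = g n := by
  let e : List ℕ × ℕ ≃ ℕ := Denumerable.eqv _
  let c : κ → List ℕ × ℕ → ℕ := fun k z => (S k z.1).toList.getD z.2 0
  let v : κ → List ℕ × ℕ → ℚ := fun k z =>
    ((Encodable.decode (α := List ℚ) (c k z)).getD []).getD z.2 0
  refine ⟨fun k n => v k (e.symm n), fun g => ?_⟩
  obtain ⟨k, hk⟩ := hS fun s => Encodable.encode ((List.range (w s)).map fun i => g (e (s, i)))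
  refine ⟨k, ?_⟩
  have hfreq : ∃ᶠ z in cofinite, v k z = g (e z) := by
    rw [frequently_cofinite_iff_infinite] at hk ⊢
    refine fun hfin => hk ((hfin.image Prod.fst).subset ?_)
    intro s hs
    obtain ⟨i, hi, his⟩ := List.getElem_of_mem (Finset.mem_toList.2 hs)
    have hiw : i < w s := (by simpa using hi : i < (S k s).card).trans_le (hw k s)
    refine ⟨(s, i), ?_, rfl⟩
    have hc : c k (s, i) = Encodable.encode ((List.range (w s)).map fun i => g (e (s, i))) := by
      simp only [c]
      rw [List.getD_eq_getElem _ _ hi, his]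
    change v k (s, i) = g (e (s, i))
    simp only [v]
    rw [hc, Encodable.encodek]
    simp [hiw]
  rw [← Nat.cofinite_eq_atTop]
  have := e.injective.tendsto_cofinite.frequently (p := fun n => v k (e.symm n) = g n)
    (hfreq.mono fun z hz => by simpa using hz)
  exact this

/-- The `i`-th Rademacher function. -/
noncomputable def rademacher (i : ℕ) (x : ℝ) : ℝ := if Int.fract (2 ^ i * x) < 1 / 2 then -1 else 1

theorem measurable_rademacher (i : ℕ) : Measurable (rademacher i) :=
  Measurable.ite (measurableSet_lt (by fun_prop) measurable_const) measurable_const measurable_const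

theorem rademacher_eq_or (i : ℕ) (x : ℝ) : rademacher i x = -1 ∨ rademacher i x = 1 := by
  unfold rademacher; split_ifs <;> simp

theorem rademacher_mul_self (i : ℕ) (x : ℝ) : rademacher i x * rademacher i x = 1 := by
  rcases rademacher_eq_or i x with h | h <;> simp [h]

theorem abs_rademacher (i : ℕ) (x : ℝ) : |rademacher i x| = 1 := by
  rcases rademacher_eq_or i x with h | h <;> simp [h]

theorem rademacher_antiperiodic (i : ℕ) :
    Function.Antiperiodic (rademacher i) ((1 / 2) ^ (i + 1)) := by
  intro x
  have h : (2 : ℝ) ^ i * (x + (1 / 2) ^ (i + 1)) = 2 ^ i * x + 1 / 2 := by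
    rw [mul_add, pow_succ, ← mul_assoc, ← mul_pow]; norm_num
  unfold rademacher
  rw [h]
  set u := (2 : ℝ) ^ i * x
  by_cases hu : Int.fract u < 1 / 2
  · have : Int.fract (u + 1 / 2) = Int.fract u + 1 / 2 := by
      rw [Int.fract_eq_iff]
      refine ⟨by linarith [Int.fract_nonneg u], by linarith, ⌊u⌋, ?_⟩
      rw [Int.fract]; ring
    rw [this, if_pos hu, if_neg (by linarith [Int.fract_nonneg u])]
    norm_num
  · have : Int.fract (u + 1 / 2) = Int.fract u - 1 / 2 := by
      rw [Int.fract_eq_iff]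
      refine ⟨by linarith, by linarith [Int.fract_lt_one u], ⌊u⌋ + 1, ?_⟩
      rw [Int.fract]; push_cast; ring
    rw [this, if_neg hu, if_pos (by linarith [Int.fract_lt_one u])]

theorem rademacher_periodic {i j : ℕ} (h : i ≤ j) :
    Function.Periodic (rademacher j) ((1 / 2) ^ i) := by
  intro x
  have h1 : (2 : ℝ) ^ j * (x + (1 / 2) ^ i) = 2 ^ j * x + ((2 ^ (j - i) : ℤ) : ℝ) := by
    obtain ⟨k, rfl⟩ := Nat.exists_eq_add_of_le h
    rw [mul_add, pow_add, mul_right_comm _ _ ((1 / 2 : ℝ) ^ i), ← mul_pow]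
    norm_num
  unfold rademacher
  rw [h1, Int.fract_add_intCast]

theorem integral_rademacher_mul_of_lt {i j : ℕ} (h : i < j) :
    ∫ x in Ico (0 : ℝ) 1, rademacher i x * rademacher j x = 0 := by
  have hp : Function.Periodic (fun x => rademacher i x * rademacher j x) 1 := by
    intro x
    have h1 := rademacher_periodic (Nat.zero_le i) x
    have h2 := rademacher_periodic (Nat.zero_le j) x
    rw [pow_zero] at h1 h2
    simp only [h1, h2]
  have h1 := hp.intervalIntegral_add_eq ((1 / 2) ^ (i + 1)) 0
  have h2 : ∫ x in (1 / 2 : ℝ) ^ (i + 1)..(1 / 2) ^ (i + 1) + 1, rademacher i x * rademacher j x =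
      -∫ x in (0 : ℝ)..1, rademacher i x * rademacher j x := by
    rw [← intervalIntegral.integral_neg]
    have h3 := intervalIntegral.integral_comp_add_right (a := 0) (b := 1)
      (fun x => rademacher i x * rademacher j x) ((1 / 2) ^ (i + 1))
    rw [zero_add, add_comm (1 : ℝ)] at h3
    rw [← h3]
    refine intervalIntegral.integral_congr fun x _ => ?_
    rw [rademacher_antiperiodic i x, rademacher_periodic h x, neg_mul]
  rw [h2, zero_add] at h1
  rw [integral_Ico_eq_integral_Ioc, ← intervalIntegral.integral_of_le zero_le_one]
  linarith

theorem integral_rademacher_mul (i j : ℕ) :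
    ∫ x in Ico (0 : ℝ) 1, rademacher i x * rademacher j x = if i = j then 1 else 0 := by
  split_ifs with h
  · subst h
    simp [rademacher_mul_self]
  · rcases lt_or_gt_of_ne h with h | h
    · exact integral_rademacher_mul_of_lt h
    · exact (integral_congr_ae (ae_of_all _ fun x => mul_comm _ _)).trans
        (integral_rademacher_mul_of_lt h)

theorem integrable_of_abs_le {α : Type*} [MeasurableSpace α] {μ : Measure α} [IsFiniteMeasure μ]
    {f : α → ℝ} (hf : Measurable f) {C : ℝ} (hC : ∀ x, |f x| ≤ C) : Integrable f μ :=
  Integrable.of_bound hf.aestronglyMeasurable C (ae_of_all _ hC)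

instance : IsProbabilityMeasure (volume.restrict (Ico (0 : ℝ) 1)) := ⟨by simp⟩

/-- Bessel's inequality for the Rademacher functions. -/
theorem card_mul_sq_le_one {c : ℝ → ℝ} (hc : Measurable c) (hc1 : ∀ x, |c x| ≤ 1) {δ : ℝ}
    (hδ : 0 ≤ δ) (I : Finset ℕ)
    (hI : ∀ i ∈ I, δ ≤ ∫ x in Ico (0 : ℝ) 1, rademacher i x * c x) : I.card * δ ^ 2 ≤ 1 := by
  have hi1 : ∀ i, Integrable (fun x => rademacher i x * c x) (volume.restrict (Ico (0 : ℝ) 1)) :=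
    fun i => integrable_of_abs_le ((measurable_rademacher i).mul hc) (C := 1) fun x => by
      rw [abs_mul, abs_rademacher, one_mul]; exact hc1 x
  have hi2 : ∀ i j, Integrable (fun x => rademacher i x * rademacher j x)
      (volume.restrict (Ico (0 : ℝ) 1)) := fun i j =>
    integrable_of_abs_le ((measurable_rademacher i).mul (measurable_rademacher j)) (C := 1)
      fun x => by simp [abs_mul, abs_rademacher]
  have hi3 : Integrable (fun x => c x ^ 2) (volume.restrict (Ico (0 : ℝ) 1)) :=
    integrable_of_abs_le (hc.pow_const 2) (C := 1) fun x => by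
      rw [abs_pow]; exact pow_le_one₀ (abs_nonneg _) (hc1 x)
  have hexp : ∀ x, (c x - δ * ∑ i ∈ I, rademacher i x) ^ 2 =
      c x ^ 2 - 2 * δ * ∑ i ∈ I, rademacher i x * c x
        + δ ^ 2 * ∑ i ∈ I, ∑ j ∈ I, rademacher i x * rademacher j x := by
    intro x
    rw [← Finset.sum_mul, ← Finset.sum_mul_sum]
    ring
  have h0 : 0 ≤ ∫ x in Ico (0 : ℝ) 1, (c x - δ * ∑ i ∈ I, rademacher i x) ^ 2 :=
    integral_nonneg fun x => sq_nonneg _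
  simp_rw [hexp] at h0
  have hs1 : Integrable (fun x => ∑ i ∈ I, rademacher i x * c x)
      (volume.restrict (Ico (0 : ℝ) 1)) := integrable_finsetSum _ fun i _ => hi1 i
  have hs2 : ∀ i, Integrable (fun x => ∑ j ∈ I, rademacher i x * rademacher j x)
      (volume.restrict (Ico (0 : ℝ) 1)) := fun i => integrable_finsetSum _ fun j _ => hi2 i j
  have hs3 : Integrable (fun x => ∑ i ∈ I, ∑ j ∈ I, rademacher i x * rademacher j x)
      (volume.restrict (Ico (0 : ℝ) 1)) := integrable_finsetSum _ fun i _ => hs2 i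
  have hs4 : Integrable (fun x => c x ^ 2 - 2 * δ * ∑ i ∈ I, rademacher i x * c x)
      (volume.restrict (Ico (0 : ℝ) 1)) := hi3.sub (hs1.const_mul _)
  rw [integral_add hs4 (hs3.const_mul _),
    integral_sub hi3 (hs1.const_mul _), integral_const_mul, integral_const_mul,
    integral_finsetSum _ fun i _ => hi1 i, integral_finsetSum _ fun i _ => hs2 i] at h0
  simp_rw [integral_finsetSum _ fun j _ => hi2 _ j, integral_rademacher_mul] at h0
  have h1 : ∫ x in Ico (0 : ℝ) 1, c x ^ 2 ≤ 1 := by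
    refine (integral_mono hi3 (integrable_const 1) fun x => ?_).trans (by simp)
    simpa using hc1 x
  have h2 : I.card * δ ≤ ∑ i ∈ I, ∫ x in Ico (0 : ℝ) 1, rademacher i x * c x := by
    simpa using Finset.sum_le_sum hI
  simp only [Finset.sum_ite_eq, Finset.sum_ite_mem, Finset.inter_self, Finset.sum_const,
    nsmul_eq_mul, mul_one] at h0
  nlinarith

/-- The `i`-th binary digit, as a real number. -/
noncomputable def digit (i : ℕ) (x : ℝ) : ℝ := (1 + rademacher i x) / 2

theorem digit_eq_or (i : ℕ) (x : ℝ) :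
    (digit i x = 0 ∧ rademacher i x = -1) ∨ (digit i x = 1 ∧ rademacher i x = 1) := by
  rcases rademacher_eq_or i x with h | h
  · left; simp [digit, h]
  · right; simp [digit, h]

theorem digit_nonneg (i : ℕ) (x : ℝ) : 0 ≤ digit i x := by
  rcases digit_eq_or i x with h | h <;> simp [h.1]

theorem digit_le_one (i : ℕ) (x : ℝ) : digit i x ≤ 1 := by
  rcases digit_eq_or i x with h | h <;> simp [h.1]

theorem measurable_digit (i : ℕ) : Measurable (digit i) := by
  have := measurable_rademacher i
  unfold digit
  fun_prop

/-- The binary fraction whose digits are the digits of `x` at the positions listed (in reverse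
order) in `σ`. -/
noncomputable def subFraction : List ℕ → ℝ → ℝ
  | [], _ => 0
  | i :: σ, x => subFraction σ x + digit i x * (1 / 2) ^ (σ.length + 1)

theorem measurable_subFraction (σ : List ℕ) : Measurable (subFraction σ) := by
  induction σ with
  | nil => exact measurable_const
  | cons i σ ih => exact ih.add ((measurable_digit i).mul_const _)

/-- The measure of the part of the section of `U` at `x` in the interval `[s x, s x + l)`. -/
noncomputable def sectionMeasure (U : Set (ℝ × ℝ)) (s : ℝ → ℝ) (l : ℝ) (x : ℝ) : ℝ :=
  volume.real (Prod.mk x ⁻¹' U ∩ Ico (s x) (s x + l))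

section sectionMeasure

variable {U : Set (ℝ × ℝ)} {s : ℝ → ℝ} {l : ℝ}

theorem sectionMeasure_nonneg (x : ℝ) : 0 ≤ sectionMeasure U s l x := measureReal_nonneg

theorem sectionMeasure_le (hl : 0 ≤ l) (x : ℝ) : sectionMeasure U s l x ≤ l := by
  refine (measureReal_mono inter_subset_right (by simp)).trans ?_
  simp [hl]

theorem measurable_sectionMeasure (hU : MeasurableSet U) (hs : Measurable s) :
    Measurable (sectionMeasure U s l) := by
  have h : MeasurableSet (U ∩ {z : ℝ × ℝ | z.2 ∈ Ico (s z.1) (s z.1 + l)}) :=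
    hU.inter ((measurableSet_le (hs.comp measurable_fst) measurable_snd).inter
      (measurableSet_lt measurable_snd ((hs.comp measurable_fst).add_const l)))
  exact (measurable_measure_prodMk_left h).ennreal_toReal

theorem sectionMeasure_split (hU : MeasurableSet U) (hl : 0 ≤ l) (x : ℝ) :
    sectionMeasure U s (l + l) x =
      sectionMeasure U s l x + sectionMeasure U (fun x => s x + l) l x := by
  have hfin : ∀ a b : ℝ, volume (Prod.mk x ⁻¹' U ∩ Ico a b) ≠ ⊤ := fun a b =>
    measure_ne_top_of_subset inter_subset_right (by simp)
  unfold sectionMeasure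
  rw [← measureReal_union ?_ ?_ (hfin _ _) (hfin _ _), ← inter_union_distrib_left,
    Ico_union_Ico_eq_Ico, add_assoc]
  · linarith
  · linarith
  · refine Disjoint.mono inter_subset_right inter_subset_right ?_
    rw [disjoint_left]
    intro y hy hy'
    exact absurd hy.2 (not_lt.2 hy'.1)
  · exact (measurable_prodMk_left hU).inter measurableSet_Ico

end sectionMeasure

/-- The relative measure of the section of `U` in the dyadic interval given by `σ`. -/
noncomputable def density (U : Set (ℝ × ℝ)) (σ : List ℕ) (x : ℝ) : ℝ :=
  2 ^ σ.length * sectionMeasure U (subFraction σ) ((1 / 2) ^ σ.length) x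

/-- Half the difference of the densities in the two halves of the dyadic interval given by `σ`. -/
noncomputable def densityGap (U : Set (ℝ × ℝ)) (σ : List ℕ) (x : ℝ) : ℝ :=
  2 ^ σ.length *
    (sectionMeasure U (fun x => subFraction σ x + (1 / 2) ^ (σ.length + 1))
        ((1 / 2) ^ (σ.length + 1)) x -
      sectionMeasure U (subFraction σ) ((1 / 2) ^ (σ.length + 1)) x)

/-- The mean over `x ∈ [0, 1)` of the density. -/
noncomputable def meanDensity (U : Set (ℝ × ℝ)) (σ : List ℕ) : ℝ :=
  ∫ x in Ico (0 : ℝ) 1, density U σ x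

theorem density_nonneg (U : Set (ℝ × ℝ)) (σ : List ℕ) (x : ℝ) : 0 ≤ density U σ x :=
  mul_nonneg (by positivity) (sectionMeasure_nonneg x)

theorem density_le_one (U : Set (ℝ × ℝ)) (σ : List ℕ) (x : ℝ) : density U σ x ≤ 1 := by
  refine (mul_le_mul_of_nonneg_left (sectionMeasure_le (by positivity) x) (by positivity)).trans ?_
  rw [← mul_pow]; norm_num

theorem measurable_density {U : Set (ℝ × ℝ)} (hU : MeasurableSet U) (σ : List ℕ) :
    Measurable (density U σ) :=
  (measurable_sectionMeasure hU (measurable_subFraction σ)).const_mul _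

theorem integrable_density {U : Set (ℝ × ℝ)} (hU : MeasurableSet U) (σ : List ℕ) :
    Integrable (density U σ) (volume.restrict (Ico (0 : ℝ) 1)) :=
  integrable_of_abs_le (measurable_density hU σ) (C := 1) fun x => by
    rw [abs_of_nonneg (density_nonneg U σ x)]; exact density_le_one U σ x

theorem measurable_densityGap {U : Set (ℝ × ℝ)} (hU : MeasurableSet U) (σ : List ℕ) :
    Measurable (densityGap U σ) :=
  ((measurable_sectionMeasure hU ((measurable_subFraction σ).add_const _)).sub
    (measurable_sectionMeasure hU (measurable_subFraction σ))).const_mul _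

theorem density_eq_add {U : Set (ℝ × ℝ)} (hU : MeasurableSet U) (σ : List ℕ) (x : ℝ) :
    density U σ x = 2 ^ σ.length *
      (sectionMeasure U (fun x => subFraction σ x + (1 / 2) ^ (σ.length + 1))
          ((1 / 2) ^ (σ.length + 1)) x +
        sectionMeasure U (subFraction σ) ((1 / 2) ^ (σ.length + 1)) x) := by
  have h : (1 / 2 : ℝ) ^ σ.length = (1 / 2) ^ (σ.length + 1) + (1 / 2) ^ (σ.length + 1) := by
    rw [pow_succ]; ring
  rw [density, h, sectionMeasure_split hU (by positivity), add_comm]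

theorem abs_densityGap_le_density {U : Set (ℝ × ℝ)} (hU : MeasurableSet U) (σ : List ℕ) (x : ℝ) :
    |densityGap U σ x| ≤ density U σ x := by
  rw [density_eq_add hU, densityGap, abs_mul, abs_of_pos (by positivity : (0 : ℝ) < 2 ^ σ.length)]
  refine mul_le_mul_of_nonneg_left ?_ (by positivity)
  refine (abs_sub _ _).trans ?_
  rw [abs_of_nonneg (sectionMeasure_nonneg x), abs_of_nonneg (sectionMeasure_nonneg x)]

theorem density_cons {U : Set (ℝ × ℝ)} (hU : MeasurableSet U) (i : ℕ) (σ : List ℕ) (x : ℝ) :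
    density U (i :: σ) x = density U σ x + rademacher i x * densityGap U σ x := by
  rw [density_eq_add hU σ, densityGap]
  unfold density
  rcases digit_eq_or i x with ⟨hd, hr⟩ | ⟨hd, hr⟩
  · have h : sectionMeasure U (subFraction (i :: σ)) ((1 / 2) ^ (σ.length + 1)) x =
        sectionMeasure U (subFraction σ) ((1 / 2) ^ (σ.length + 1)) x := by
      simp [sectionMeasure, subFraction, hd]
    rw [hr, List.length_cons, h]
    ring
  · have h : sectionMeasure U (subFraction (i :: σ)) ((1 / 2) ^ (σ.length + 1)) x =
        sectionMeasure U (fun x => subFraction σ x + (1 / 2) ^ (σ.length + 1))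
          ((1 / 2) ^ (σ.length + 1)) x := by
      simp [sectionMeasure, subFraction, hd]
    rw [hr, List.length_cons, h]
    ring

theorem integrable_rademacher_mul_densityGap {U : Set (ℝ × ℝ)} (hU : MeasurableSet U) (i : ℕ)
    (σ : List ℕ) : Integrable (fun x => rademacher i x * densityGap U σ x)
      (volume.restrict (Ico (0 : ℝ) 1)) :=
  integrable_of_abs_le ((measurable_rademacher i).mul (measurable_densityGap hU σ)) (C := 1)
    fun x => by
      rw [abs_mul, abs_rademacher, one_mul]
      exact (abs_densityGap_le_density hU σ x).trans (density_le_one U σ x)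

theorem meanDensity_cons {U : Set (ℝ × ℝ)} (hU : MeasurableSet U) (i : ℕ) (σ : List ℕ) :
    meanDensity U (i :: σ) =
      meanDensity U σ + ∫ x in Ico (0 : ℝ) 1, rademacher i x * densityGap U σ x := by
  simp_rw [meanDensity, density_cons hU]
  exact integral_add (integrable_density hU σ) (integrable_rademacher_mul_densityGap hU i σ)

theorem meanDensity_cons_le {U : Set (ℝ × ℝ)} (hU : MeasurableSet U) (i : ℕ) (σ : List ℕ) :
    meanDensity U (i :: σ) ≤ 2 * meanDensity U σ := by
  rw [meanDensity_cons hU, two_mul, add_le_add_iff_left]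
  refine integral_mono (integrable_rademacher_mul_densityGap hU i σ) (integrable_density hU σ) ?_
  intro x
  refine (le_abs_self _).trans ?_
  simp only [abs_mul, abs_rademacher, one_mul]
  exact abs_densityGap_le_density hU σ x

theorem ofReal_meanDensity {U : Set (ℝ × ℝ)} (hU : MeasurableSet U) (σ : List ℕ) :
    ENNReal.ofReal (meanDensity U σ) = ∫⁻ x in Ico (0 : ℝ) 1, ENNReal.ofReal (density U σ x) :=
  ofReal_integral_eq_lintegral_ofReal (integrable_density hU σ)
    (ae_of_all _ (density_nonneg U σ))

theorem ofReal_meanDensity_nil_le {U : Set (ℝ × ℝ)} (hU : MeasurableSet U) :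
    ENNReal.ofReal (meanDensity U []) ≤ volume U := by
  rw [ofReal_meanDensity hU, Measure.volume_eq_prod, Measure.prod_apply hU]
  refine (lintegral_mono fun x => ?_).trans (setLIntegral_le_lintegral _ _)
  simp only [density, List.length_nil, pow_zero, one_mul, sectionMeasure]
  exact ENNReal.ofReal_toReal_le.trans (measure_mono inter_subset_left)

theorem card_le_four_pow {U : Set (ℝ × ℝ)} (hU : MeasurableSet U) (σ : List ℕ) (n : ℕ)
    (I : Finset ℕ)
    (hI : ∀ i ∈ I, meanDensity U σ + (1 / 2) ^ n < meanDensity U (i :: σ)) : I.card ≤ 4 ^ n := by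
  have h := card_mul_sq_le_one (measurable_densityGap hU σ)
    (fun x => (abs_densityGap_le_density hU σ x).trans (density_le_one U σ x))
    (δ := (1 / 2) ^ n) (by positivity) I fun i hi => by
      have := hI i hi
      rw [meanDensity_cons hU] at this
      linarith
  rw [← pow_mul, mul_comm n, pow_mul, one_div, inv_pow, inv_pow, ← div_eq_mul_inv,
    div_le_one (by positivity)] at h
  norm_num at h
  exact_mod_cast h

theorem exists_finset_meanDensity {U : Set (ℝ × ℝ)} (hU : MeasurableSet U) (σ : List ℕ) (n : ℕ) :
    ∃ S : Finset ℕ, S.card ≤ 4 ^ n ∧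
      ∀ i ∉ S, meanDensity U (i :: σ) ≤ meanDensity U σ + (1 / 2) ^ n := by
  have hfin : {i | meanDensity U σ + (1 / 2) ^ n < meanDensity U (i :: σ)}.Finite := by
    by_contra hinf
    obtain ⟨I, hI, hcard⟩ := Set.Infinite.exists_subset_card_eq hinf (4 ^ n + 1)
    have := card_le_four_pow hU σ n I fun i hi => hI hi
    omega
  refine ⟨hfin.toFinset, card_le_four_pow hU σ n _ fun i hi => by simpa using hi, fun i hi => ?_⟩
  simpa using hi

/-- The branch through the tree of finite sequences determined by a predictor `g`. -/
def branch (g : List ℕ → ℕ) : ℕ → List ℕ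
  | 0 => []
  | n + 1 => g (branch g n) :: branch g n

theorem length_branch (g : List ℕ → ℕ) (n : ℕ) : (branch g n).length = n := by
  induction n with
  | zero => rfl
  | succ n ih => simp [branch, ih]

theorem branch_injective (g : List ℕ → ℕ) : Function.Injective (branch g) := fun m n h => by
  rw [← length_branch g m, ← length_branch g n, h]

/-- The real whose digits are the digits of `x` at the positions along a branch. -/
noncomputable def branchReal (g : List ℕ → ℕ) (x : ℝ) : ℝ :=
  ∑' n, digit (g (branch g n)) x * (1 / 2) ^ (n + 1)

theorem subFraction_branch (g : List ℕ → ℕ) (n : ℕ) (x : ℝ) :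
    subFraction (branch g n) x =
      ∑ j ∈ Finset.range n, digit (g (branch g j)) x * (1 / 2) ^ (j + 1) := by
  induction n with
  | zero => rfl
  | succ n ih => rw [Finset.sum_range_succ, branch, subFraction, ih, length_branch]

theorem tendsto_subFraction_branch (g : List ℕ → ℕ) (x : ℝ) :
    Tendsto (fun n => subFraction (branch g n) x) atTop (nhds (branchReal g x)) := by
  simp_rw [subFraction_branch]
  refine Summable.tendsto_sum_tsum_nat (Summable.of_nonneg_of_le
    (fun n => mul_nonneg (digit_nonneg _ _) (by positivity)) (fun n => ?_) summable_geometric_two)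
  rw [pow_succ]
  have h1 := digit_le_one (g (branch g n)) x
  have h2 := digit_nonneg (g (branch g n)) x
  have h3 : (0 : ℝ) < (1 / 2) ^ n := by positivity
  nlinarith

theorem measurable_branchReal (g : List ℕ → ℕ) : Measurable (branchReal g) :=
  measurable_of_tendsto_metrizable (fun n => measurable_subFraction (branch g n))
    (tendsto_pi_nhds.2 (tendsto_subFraction_branch g))

theorem eventually_density_branch_eq_one {U : Set (ℝ × ℝ)} (hU : IsOpen U) (g : List ℕ → ℕ)
    {x : ℝ} (hx : (x, branchReal g x) ∈ U) : ∀ᶠ n in atTop, density U (branch g n) x = 1 := by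
  obtain ⟨ρ, hρ, hball⟩ := Metric.isOpen_iff.1
    (hU.preimage (by fun_prop : Continuous (Prod.mk x))) _ hx
  have h1 := (tendsto_subFraction_branch g x).eventually (Metric.ball_mem_nhds _ (half_pos hρ))
  have h2 := (tendsto_pow_atTop_nhds_zero_of_lt_one (by norm_num : (0 : ℝ) ≤ 1 / 2)
    (by norm_num)).eventually (gt_mem_nhds (half_pos hρ))
  filter_upwards [h1, h2] with n hn1 hn2
  have hsub : Ico (subFraction (branch g n) x) (subFraction (branch g n) x + (1 / 2) ^ n) ⊆
      Prod.mk x ⁻¹' U := by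
    refine subset_trans ?_ hball
    intro y hy
    rw [Real.dist_eq, abs_lt] at hn1
    rw [Metric.mem_ball, Real.dist_eq, abs_lt]
    constructor <;> linarith [hy.1, hy.2]
  rw [density, sectionMeasure, length_branch, inter_eq_right.2 hsub, Real.volume_real_Ico_of_le
    (by simp), add_sub_cancel_left, ← mul_pow]
  norm_num

theorem volume_branchReal_mem_le {U : Set (ℝ × ℝ)} (hU : IsOpen U) (g : List ℕ → ℕ) {C : ℝ}
    (hC : ∀ᶠ n in atTop, meanDensity U (branch g n) ≤ C) :
    volume {x | x ∈ Ico (0 : ℝ) 1 ∧ (x, branchReal g x) ∈ U} ≤ ENNReal.ofReal C := by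
  have hW : MeasurableSet {x | (x, branchReal g x) ∈ U} :=
    (measurable_id.prodMk (measurable_branchReal g)) hU.measurableSet
  calc volume {x | x ∈ Ico (0 : ℝ) 1 ∧ (x, branchReal g x) ∈ U}
      = ∫⁻ x in Ico (0 : ℝ) 1, {x | (x, branchReal g x) ∈ U}.indicator 1 x := by
        rw [lintegral_indicator_one hW, Measure.restrict_apply hW, inter_comm]
        rfl
    _ ≤ ∫⁻ x in Ico (0 : ℝ) 1, liminf (fun n => ENNReal.ofReal (density U (branch g n) x)) atTop := by
        refine lintegral_mono fun x => ?_
        by_cases hx : (x, branchReal g x) ∈ U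
        · rw [indicator_of_mem (by exact hx)]
          refine le_liminf_of_le (by isBoundedDefault) ?_
          filter_upwards [eventually_density_branch_eq_one hU g hx] with n hn
          simp [hn]
        · rw [indicator_of_notMem (by exact hx)]
          exact zero_le
    _ ≤ liminf (fun n => ∫⁻ x in Ico (0 : ℝ) 1, ENNReal.ofReal (density U (branch g n) x)) atTop :=
        lintegral_liminf_le fun n => (measurable_density hU.measurableSet _).ennreal_ofReal
    _ ≤ ENNReal.ofReal C := by
        refine liminf_le_of_frequently_le' (Eventually.frequently ?_)
        filter_upwards [hC] with n hn
        rw [← ofReal_meanDensity hU.measurableSet]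
        exact ENNReal.ofReal_le_ofReal hn

theorem meanDensity_branch_le_two_pow {U : Set (ℝ × ℝ)} (hU : MeasurableSet U) (g : List ℕ → ℕ)
    (n : ℕ) : meanDensity U (branch g n) ≤ 2 ^ n * meanDensity U [] := by
  induction n with
  | zero => simp [branch]
  | succ n ih =>
    refine (meanDensity_cons_le hU _ _).trans ?_
    rw [pow_succ]
    linarith

/-- Every null set of the plane is captured, along branches, by slaloms of fixed widths. -/
theorem exists_slalom_of_volume_eq_zero {H : Set (ℝ × ℝ)} (hH : volume H = 0) :
    ∃ S : List ℕ → Finset ℕ, (∀ σ, (S σ).card ≤ (σ.length + 1) * 4 ^ σ.length) ∧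
      ∀ g : List ℕ → ℕ, (∀ᶠ σ in cofinite, g σ ∉ S σ) →
        volume {x | x ∈ Ico (0 : ℝ) 1 ∧ (x, branchReal g x) ∈ H} = 0 := by
  have hex : ∀ m : ℕ, ∃ U ⊇ H, IsOpen U ∧ volume U < ENNReal.ofReal ((1 / 4) ^ m) := fun m =>
    exists_isOpen_lt_of_lt H _ (by rw [hH, ENNReal.ofReal_pos]; positivity)
  choose U hHU hU hvol using hex
  have hUm := fun m => (hU m).measurableSet
  choose S hS hSU using fun m σ => exists_finset_meanDensity (hUm m) σ σ.length
  refine ⟨fun σ => (Finset.range (σ.length + 1)).biUnion fun m => S m σ, fun σ => ?_, ?_⟩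
  · refine (Finset.card_biUnion_le_card_mul _ _ _ fun m _ => hS m σ).trans ?_
    rw [Finset.card_range]
  · intro g hg
    have hev : ∀ᶠ n in atTop, ∀ m ≤ n, g (branch g n) ∉ S m (branch g n) := by
      rw [← Nat.cofinite_eq_atTop]
      filter_upwards [(branch_injective g).tendsto_cofinite.eventually hg] with n hn m hm hmem
      refine hn (Finset.mem_biUnion.2 ⟨m, ?_, hmem⟩)
      rw [length_branch, Finset.mem_range]
      omega
    obtain ⟨n₀, hn₀⟩ := eventually_atTop.1 hev
    have hbound : ∀ m ≥ n₀, volume {x | x ∈ Ico (0 : ℝ) 1 ∧ (x, branchReal g x) ∈ H} ≤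
        ENNReal.ofReal (3 * (1 / 2) ^ m) := by
      intro m hm
      have hind : ∀ n ≥ m,
          meanDensity (U m) (branch g n) ≤ 3 * (1 / 2) ^ m - 2 * (1 / 2) ^ n := by
        intro n hn
        induction n, hn using Nat.le_induction with
        | base =>
          have h1 := meanDensity_branch_le_two_pow (hUm m) g m
          have h2 := (ENNReal.ofReal_le_ofReal_iff (by positivity)).1
            ((ofReal_meanDensity_nil_le (hUm m)).trans (hvol m).le)
          have h3 : (2 : ℝ) ^ m * (1 / 4) ^ m = (1 / 2) ^ m := by rw [← mul_pow]; norm_num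
          have h4 : (2 : ℝ) ^ m * meanDensity (U m) [] ≤ 2 ^ m * (1 / 4) ^ m := by gcongr
          linarith
        | succ n hn ih =>
          have h1 := hSU m (branch g n) (g (branch g n)) (hn₀ n (hm.trans hn) m hn)
          rw [length_branch] at h1
          rw [branch, pow_succ]
          linarith
      have hsub : {x | x ∈ Ico (0 : ℝ) 1 ∧ (x, branchReal g x) ∈ H} ⊆
          {x | x ∈ Ico (0 : ℝ) 1 ∧ (x, branchReal g x) ∈ U m} := fun x hx => ⟨hx.1, hHU m hx.2⟩
      refine (measure_mono hsub).trans (volume_branchReal_mem_le (hU m) g ?_)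
      filter_upwards [eventually_ge_atTop m] with n hn
      have h5 : (0 : ℝ) ≤ (1 / 2) ^ n := by positivity
      linarith [hind n hn]
    refine le_antisymm (ge_of_tendsto ?_ (eventually_atTop.2 ⟨n₀, hbound⟩)) zero_le
    have ht := ENNReal.tendsto_ofReal ((tendsto_pow_atTop_nhds_zero_of_lt_one
      (by norm_num : (0 : ℝ) ≤ 1 / 2) (by norm_num)).const_mul 3)
    simpa using ht

theorem exists_dominating_of_countable {α : Type} [Encodable α] {F : Set (ℕ → ℕ)}
    (hF : ∀ g : ℕ → ℕ, ∃ f ∈ F, ∀ᶠ n in atTop, g n ≤ f n) (G : α → ℕ) :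
    ∃ f : F, ∀ᶠ a in cofinite, G a ≤ f.1 (Encodable.encode a) := by
  obtain ⟨f, hf, hGf⟩ := hF (Function.extend Encodable.encode G 0)
  refine ⟨⟨f, hf⟩, ?_⟩
  rw [← Nat.cofinite_eq_atTop] at hGf
  filter_upwards [Encodable.encode_injective.tendsto_cofinite.eventually hGf] with a ha
  rwa [Encodable.encode_injective.extend_apply] at ha

theorem exists_dominating_family : ∃ F : Set (ℕ → ℕ), #F = frakd ∧
    ∀ g : ℕ → ℕ, ∃ f ∈ F, ∀ᶠ n in atTop, g n ≤ f n :=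
  csInf_mem (s := { c : Cardinal | ∃ F : Set (ℕ → ℕ), #F = c ∧
    ∀ g : ℕ → ℕ, ∃ f ∈ F, ∀ᶠ n in atTop, g n ≤ f n })
    ⟨_, Set.univ, rfl, fun g => ⟨g, mem_univ _, Eventually.of_forall fun _ => le_rfl⟩⟩

theorem aleph0_le_frakd : ℵ₀ ≤ frakd := by
  obtain ⟨F, hF, hdom⟩ := exists_dominating_family
  rw [← hF]
  by_contra! hlt
  have hfin : F.Finite := lt_aleph0_iff_set_finite.1 hlt
  obtain ⟨f, hf, hn⟩ := hdom fun n => ∑ f ∈ hfin.toFinset, f n + 1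
  obtain ⟨n, hn⟩ := hn.exists
  have : f n ≤ ∑ f ∈ hfin.toFinset, f n :=
    Finset.single_le_sum (f := fun f : ℕ → ℕ => f n) (fun _ _ => Nat.zero_le _)
      (hfin.mem_toFinset.2 hf)
  omega

theorem covStarN_le_of_not_isMeagre {X : Set ℝ} (hX : ¬ IsMeagre X) : covStarN ≤ #X := by
  obtain ⟨A, hA, hnull, hcov⟩ := mem_covStarN_set_of_not_isMeagre hX
  have hle : covStarN ≤ #A := csInf_le' ⟨A, rfl, hnull, hcov⟩
  exact hle.trans hA

theorem not_isMeagre_univ_real : ¬ IsMeagre (Set.univ : Set ℝ) :=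
  not_isMeagre_of_isOpen isOpen_univ univ_nonempty

theorem covStarN_le_nonMeager : covStarN ≤ nonMeager := by
  refine le_csInf ⟨_, Set.univ, rfl, not_isMeagre_univ_real⟩ ?_
  rintro _ ⟨X, rfl, hX⟩
  exact covStarN_le_of_not_isMeagre hX

theorem exists_covStarN_family : ∃ A : Set (Set (ℝ × ℝ)), #A = covStarN ∧
    (∀ H ∈ A, volume H = 0) ∧
    ∀ f : ℝ → ℝ, Measurable f → ∀ B : Set ℝ, MeasurableSet B → 0 < volume B →
      ∃ H ∈ A, volume {x | x ∈ B ∧ (x, f x) ∈ H} ≠ 0 := by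
  obtain ⟨A, -, hnull, hcov⟩ := mem_covStarN_set_of_not_isMeagre not_isMeagre_univ_real
  exact csInf_mem (s := { c : Cardinal | ∃ A : Set (Set (ℝ × ℝ)), #A = c ∧
    (∀ H ∈ A, volume H = 0) ∧
    ∀ f : ℝ → ℝ, Measurable f → ∀ B : Set ℝ, MeasurableSet B → 0 < volume B →
      ∃ H ∈ A, volume {x | x ∈ B ∧ (x, f x) ∈ H} ≠ 0 }) ⟨_, A, rfl, hnull, hcov⟩

theorem nonMeager_le_mul : nonMeager ≤ frakd * covStarN := by
  obtain ⟨F, hF, hdom⟩ := exists_dominating_family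
  obtain ⟨A, hA, hnull, hcov⟩ := exists_covStarN_family
  choose S hS hSg using fun H : A => exists_slalom_of_volume_eq_zero (hnull H.1 H.2)
  obtain ⟨f, hf⟩ := exists_infinitely_equal_of_slaloms _ S hS fun g => by
    obtain ⟨H, hH, hpos⟩ := hcov (branchReal g) (measurable_branchReal g) (Ico 0 1)
      measurableSet_Ico (by simp)
    refine ⟨⟨H, hH⟩, fun hev => hpos (hSg ⟨H, hH⟩ g hev)⟩
  have hX := not_isMeagre_range_sumReal (fun (φ : F) s => φ.1 (Encodable.encode s)) f
    (exists_dominating_of_countable hdom) hf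
  calc nonMeager ≤ #(range fun z : F × A =>
        sumReal (fun s => z.1.1 (Encodable.encode s)) (f z.2)) := csInf_le' ⟨_, rfl, hX⟩
    _ ≤ #(F × A) := mk_range_le
    _ = frakd * covStarN := by rw [mk_prod, lift_id, lift_id, hF, hA]

/-- If `cov*(𝒩) ≥ 𝔡` then `cov*(𝒩) = non(ℳ)`. -/
theorem covStarN_eq_nonMeager (h : frakd ≤ covStarN) : covStarN = nonMeager := by
  refine le_antisymm covStarN_le_nonMeager (nonMeager_le_mul.trans ?_)
  rw [mul_eq_right (aleph0_le_frakd.trans h) h (aleph0_pos.trans_le aleph0_le_frakd).ne']
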